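/- arXiv:2502.10201 — 4 statements merged into one kernel-verified Lean document; each statement's English description precedes it below -/
import Mathlib

section
/- Let X be a nonempty finite set, let v ≥ 2 be a natural number, and for each x ∈ X let p(·|x) : Fin v → ℝ be a probability vector (p(j|x) ≥ 0 for all j and Σ_{j=1}^v p(j|x) = 1). Define the dissimilarity d(x,j) = 1 − p(j|x). Then the variance of d(x,y), with x uniform on X and y uniform on {1,…,v}, satisfies Var_{x,y}[d(x,y)] = (1/|X|) Σ_{x∈X} (1/v) Σ_{j=1}^v (p(j|x) − 1/v)², i.e., the variance equals the average over x of (1/v times) the squared L2 distance between the probability vector p(·|x) and the uniform distribution on the v labels. -/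
/-- The variance of the probability-distance dissimilarity `d(x,j) = 1 - p(j|x)`,
with `x` uniform on `X` and `j` uniform on the `v` labels, equals the average over
`x` of (`1/v` times) the squared L2 distance of `p(·|x)` to the uniform distribution. -/
theorem variance_prob_distance
    (X : Type*) [Fintype X] [Nonempty X]
    (v : ℕ) (hv : 2 ≤ v)
    (p : X → Fin v → ℝ)
    (hp_nonneg : ∀ x j, 0 ≤ p x j)
    (hp_sum : ∀ x, ∑ j, p x j = 1) :
    (Fintype.card X : ℝ)⁻¹ * (v : ℝ)⁻¹ *
        ∑ x, ∑ j, ((1 - p x j) -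
          (Fintype.card X : ℝ)⁻¹ * (v : ℝ)⁻¹ * ∑ x', ∑ j', (1 - p x' j')) ^ 2
      = (Fintype.card X : ℝ)⁻¹ * ∑ x, (v : ℝ)⁻¹ * ∑ j, (p x j - 1 / v) ^ 2 := by
  have hv0 : (v : ℝ) ≠ 0 := by
    have : v ≠ 0 := by omega
    exact_mod_cast this
  have hX0 : (Fintype.card X : ℝ) ≠ 0 := by
    exact_mod_cast Fintype.card_ne_zero
  have mean_eq : (Fintype.card X : ℝ)⁻¹ * (v : ℝ)⁻¹ * ∑ x', ∑ j', (1 - p x' j')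
      = 1 - 1 / v := by
    simp only [Finset.sum_sub_distrib, hp_sum, Finset.sum_const, Finset.card_univ,
      Fintype.card_fin, nsmul_eq_mul, mul_one]
    field_simp
  rw [mean_eq, ← Finset.mul_sum, mul_assoc]
  have sq_eq (x : X) (j : Fin v) :
      ((1 - p x j) - (1 - 1 / (v : ℝ))) ^ 2 = (p x j - 1 / v) ^ 2 := by ring
  simp only [sq_eq]
end

section
/- Let X be a nonempty finite set, let v ≥ 2 be a natural number, and for each x ∈ X let p(·|x) : Fin v → ℝ be a probability vector (p(j|x) ≥ 0 for all j and Σ_{j=1}^v p(j|x) = 1). Define the dissimilarity d(x,j) = 1 − p(j|x). Then the relative-variance ratio satisfies Var_{x,y}[d(x,y)] / (E_{x,y}[d(x,y)])² = (v/(v−1))² · (1/|X|) Σ_{x∈X} (1/v) Σ_{j=1}^v (p(j|x) − 1/v)², where x is uniform on X and y is uniform on {1,…,v}. -/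
/-- The relative-variance ratio `Var[d]/E[d]^2` of the probability-distance
dissimilarity `d(x,j) = 1 - p(j|x)`, with `x` uniform on `X` and `j` uniform on
the `v` labels, equals `(v/(v-1))^2` times the mean squared L2 distance of the
conditional distributions to the uniform distribution. -/
theorem relative_variance_prob_distance
    (X : Type*) [Fintype X] [Nonempty X]
    (v : ℕ) (hv : 2 ≤ v)
    (p : X → Fin v → ℝ)
    (hp_nonneg : ∀ x j, 0 ≤ p x j)
    (hp_sum : ∀ x, ∑ j, p x j = 1) :
    ((Fintype.card X : ℝ)⁻¹ * (v : ℝ)⁻¹ *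
        ∑ x, ∑ j, ((1 - p x j) -
          (Fintype.card X : ℝ)⁻¹ * (v : ℝ)⁻¹ * ∑ x', ∑ j', (1 - p x' j')) ^ 2) /
      ((Fintype.card X : ℝ)⁻¹ * (v : ℝ)⁻¹ * ∑ x, ∑ j, (1 - p x j)) ^ 2
    = ((v : ℝ) / ((v : ℝ) - 1)) ^ 2 *
        ((Fintype.card X : ℝ)⁻¹ * ∑ x, (v : ℝ)⁻¹ * ∑ j, (p x j - 1 / v) ^ 2) := by
  have hv_two : (2 : ℝ) ≤ v := by exact_mod_cast hv
  have hv_ne : (v : ℝ) ≠ 0 := by linarith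
  have hv_sub : (v : ℝ) - 1 ≠ 0 := by linarith
  have h_card : (Fintype.card X : ℝ) ≠ 0 := by exact_mod_cast Fintype.card_ne_zero
  have h_mean : (Fintype.card X : ℝ)⁻¹ * (v : ℝ)⁻¹ * ∑ x, ∑ j, (1 - p x j)
      = ((v : ℝ) - 1) / v := by
    simp only [Finset.sum_sub_distrib, hp_sum, Finset.sum_const, Finset.card_univ,
      Fintype.card_fin, nsmul_eq_mul, mul_one]
    field_simp
  have h_dev : ∀ x j, ((1 - p x j) - ((v : ℝ) - 1) / v) ^ 2 = (p x j - 1 / v) ^ 2 := by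
    intro x j
    field_simp
    ring
  simp only [h_mean, h_dev]
  rw [← Finset.mul_sum]
  field_simp
end

section
/- Let X be a nonempty finite set, let v ≥ 2 be a natural number, and for each m ∈ ℕ and each x ∈ X let p_m(·|x) : Fin v → ℝ be a probability vector (p_m(j|x) ≥ 0 for all j and Σ_{j=1}^v p_m(j|x) = 1). For each m define the dissimilarity d_m(x,j) = 1 − p_m(j|x). If the sequence of mean squared L2 distances to the uniform distribution, D_m := (1/|X|) Σ_{x∈X} (1/v) Σ_{j=1}^v (p_m(j|x) − 1/v)², does not tend to 0 as m → ∞, then the sequence of ratios Var_{x,y}[d_m(x,y)] / (E_{x,y}[d_m(x,y)])² (with x uniform on X and y uniform on {1,…,v}) does not tend to 0 as m → ∞. -/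
/-- The mean over contexts and labels of `1 - p(j|x)` is `1 - 1 / v`. -/
theorem mean_one_sub_prob {X : Type*} [Fintype X] [Nonempty X] {v : ℕ} (hv : v ≠ 0)
    {p : X → Fin v → ℝ} (hp : ∀ x, ∑ j, p x j = 1) :
    (Fintype.card X : ℝ)⁻¹ * (v : ℝ)⁻¹ * ∑ x, ∑ j, (1 - p x j) = 1 - 1 / v := by
  have hX : (Fintype.card X : ℝ) ≠ 0 := Nat.cast_ne_zero.mpr Fintype.card_ne_zero
  have hv' : (v : ℝ) ≠ 0 := Nat.cast_ne_zero.mpr hv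
  simp only [Finset.sum_sub_distrib, hp, Finset.sum_const, Finset.card_univ, Fintype.card_fin,
    nsmul_eq_mul, mul_one]
  field_simp


/-- If the mean squared L2 distance of the conditional distributions `p_m(·|x)` to
the uniform distribution does not tend to `0` as `m → ∞`, then the relative-variance
ratio `Var[d_m]/E[d_m]^2` of the dissimilarities `d_m(x,j) = 1 - p_m(j|x)` does not
tend to `0` either (so there is no concentration of distances). -/
theorem no_concentration_of_prob_distance
    (X : Type*) [Fintype X] [Nonempty X]
    (v : ℕ) (hv : 2 ≤ v)
    (p : ℕ → X → Fin v → ℝ)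
    (hp_nonneg : ∀ m x j, 0 ≤ p m x j)
    (hp_sum : ∀ m x, ∑ j, p m x j = 1)
    (hD : ¬ Filter.Tendsto
        (fun m => (Fintype.card X : ℝ)⁻¹ * ∑ x, (v : ℝ)⁻¹ * ∑ j, (p m x j - 1 / v) ^ 2)
        Filter.atTop (nhds 0)) :
    ¬ Filter.Tendsto
        (fun m =>
          ((Fintype.card X : ℝ)⁻¹ * (v : ℝ)⁻¹ *
              ∑ x, ∑ j, ((1 - p m x j) -
                (Fintype.card X : ℝ)⁻¹ * (v : ℝ)⁻¹ * ∑ x', ∑ j', (1 - p m x' j')) ^ 2) /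
            ((Fintype.card X : ℝ)⁻¹ * (v : ℝ)⁻¹ * ∑ x, ∑ j, (1 - p m x j)) ^ 2)
        Filter.atTop (nhds 0) := by
  intro h
  apply hD
  have hv₁ : (1 : ℝ) < v := by exact_mod_cast hv
  have hmean : (1 - 1 / (v : ℝ)) ^ 2 ≠ 0 :=
    pow_ne_zero 2 (sub_pos.mpr ((div_lt_one (by linarith)).mpr hv₁)).ne'
  have h' := h.mul_const ((1 - 1 / (v : ℝ)) ^ 2)
  rw [zero_mul] at h'
  refine h'.congr fun m => ?_
  rw [mean_one_sub_prob (by omega) (hp_sum m), div_mul_cancel₀ _ hmean, mul_assoc,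
    Finset.mul_sum]
  refine congrArg _ (Finset.sum_congr rfl fun x _ => congrArg _
    (Finset.sum_congr rfl fun j _ => ?_))
  ring
end

section
/- Let X be a nonempty finite set, let v ≥ 2 be a natural number, let ε > 0, and suppose that for each m ∈ ℕ and each x ∈ X, p_m(·|x) : Fin v → ℝ is a probability vector (p_m(j|x) ≥ 0 for all j and Σ_{j=1}^v p_m(j|x) = 1). Define d_m(x,j) = 1 − p_m(j|x). If for some m we have (1/|X|) Σ_{x∈X} (1/v) Σ_{j=1}^v (p_m(j|x) − 1/v)² ≥ ε, then for that m the ratio Var_{x,y}[d_m(x,y)] / (E_{x,y}[d_m(x,y)])² is at least (v/(v−1))² · ε (with x uniform on X and y uniform on {1,…,v}). -/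
/-- Quantitative lower bound: if for some dimension `m` the mean squared L2 distance
of the conditional distributions `p_m(·|x)` to the uniform distribution is at least
`ε`, then the relative-variance ratio `Var[d_m]/E[d_m]^2` of the dissimilarity
`d_m(x,j) = 1 - p_m(j|x)` is at least `(v/(v-1))^2 * ε`. -/
theorem relative_variance_lower_bound
    (X : Type*) [Fintype X] [Nonempty X]
    (v : ℕ) (hv : 2 ≤ v)
    (ε : ℝ) (hε : 0 < ε)
    (p : ℕ → X → Fin v → ℝ)
    (hp_nonneg : ∀ m x j, 0 ≤ p m x j)
    (hp_sum : ∀ m x, ∑ j, p m x j = 1)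
    (m : ℕ)
    (hD : ε ≤ (Fintype.card X : ℝ)⁻¹ * ∑ x, (v : ℝ)⁻¹ * ∑ j, (p m x j - 1 / v) ^ 2) :
    ((v : ℝ) / ((v : ℝ) - 1)) ^ 2 * ε ≤
      ((Fintype.card X : ℝ)⁻¹ * (v : ℝ)⁻¹ *
          ∑ x, ∑ j, ((1 - p m x j) -
            (Fintype.card X : ℝ)⁻¹ * (v : ℝ)⁻¹ * ∑ x', ∑ j', (1 - p m x' j')) ^ 2) /
        ((Fintype.card X : ℝ)⁻¹ * (v : ℝ)⁻¹ * ∑ x, ∑ j, (1 - p m x j)) ^ 2 := by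
  have hv0 : (v : ℝ) ≠ 0 := by positivity
  have hv1 : (v : ℝ) - 1 ≠ 0 := by
    have : (2 : ℝ) ≤ v := by exact_mod_cast hv
    linarith
  have hX : (Fintype.card X : ℝ) ≠ 0 := by simp
  have hmean : (Fintype.card X : ℝ)⁻¹ * (v : ℝ)⁻¹ * ∑ x, ∑ j, (1 - p m x j) =
      ((v : ℝ) - 1) / v := by
    simp only [Finset.sum_sub_distrib, hp_sum, Finset.sum_const, Finset.card_univ,
      Fintype.card_fin, nsmul_eq_mul, mul_one]
    field_simp
  have hvar : (Fintype.card X : ℝ)⁻¹ * (v : ℝ)⁻¹ *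
      ∑ x, ∑ j, ((1 - p m x j) - ((v : ℝ) - 1) / v) ^ 2 =
      (Fintype.card X : ℝ)⁻¹ * ∑ x, (v : ℝ)⁻¹ * ∑ j, (p m x j - 1 / v) ^ 2 := by
    rw [← Finset.mul_sum, mul_assoc]
    congr 2
    refine Finset.sum_congr rfl fun x _ => Finset.sum_congr rfl fun j _ => ?_
    field_simp
    ring
  rw [hmean, hvar, div_eq_mul_inv _ ((((v : ℝ) - 1) / v) ^ 2), ← inv_pow, inv_div, mul_comm]
  gcongr
end
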